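/- Let p ∈ (0,1) and let (G_t)_{t≥1} be the preferential attachment process with edge-steps with parameter p, and set c_p = 1 − p/2. Then for every ε > 0 there exist positive constants C₁, C₂ and δ, depending only on ε and p, such that for all t, P( there exists a vertex j of G_t with d_t(j) ≥ C₁ · t^{c_p(1−ε)} ) ≥ 1 − C₂ · t^{−δ}. -/

import Mathlib

open MeasureTheory Filter

attribute [local instance] Classical.propDecidable

/-- Degree of vertex `i` at time `t` computed from the endpoint process `ep`:
the edge added at step `s` contributes `1` for each of its endpoints equal to `i`
(so a loop at `i` contributes `2`). -/
noncomputable def degOf {Ω : Type} (ep : ℕ → Ω → ℕ × ℕ) (t i : ℕ) (ω : Ω) : ℕ :=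
  ∑ s ∈ Finset.Icc 1 t,
    ((if (ep s ω).1 = i then 1 else 0) + (if (ep s ω).2 = i then 1 else 0))

/-- The preferential attachment random graph process with edge-steps and parameter `p`.
`G_1` is a single vertex (labeled `1`) with a loop.  At each step `t + 1` (for `t ≥ 1`),
with probability `p` a vertex-step occurs: a new vertex `nv t + 1` is added together with an
edge to an old vertex `u`, chosen with probability `d_t(u) / (2t)`; with probability `1 - p`
an edge-step occurs: an edge `{u, w}` is added, where `u` and `w` are chosen independently,
each with probability proportional to its degree.  The field `ep t` records the (ordered pair
of) endpoints of the unique edge added at step `t`, `nv t` is the number of vertices of `G_t`,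
and `Z t` tells whether step `t` was a vertex-step.  The one-step conditional laws are
prescribed via conditional expectations with respect to a filtration `ℱ` to which the process
is adapted. -/
structure PAProcess (p : ℝ) where
  Ω : Type
  m0 : MeasurableSpace Ω
  μ : Measure Ω
  isProb : IsProbabilityMeasure μ
  ℱ : Filtration ℕ m0
  Z : ℕ → Ω → Bool
  nv : ℕ → Ω → ℕ
  ep : ℕ → Ω → ℕ × ℕ
  nv_one : ∀ ω, nv 1 ω = 1
  ep_one : ∀ ω, ep 1 ω = (1, 1)
  nv_succ : ∀ t, 1 ≤ t → ∀ ω, nv (t + 1) ω = nv t ω + (if Z (t + 1) ω then 1 else 0)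
  ep_vertexStep : ∀ t, 1 ≤ t → ∀ ω, Z (t + 1) ω = true →
    (ep (t + 1) ω).2 = nv t ω + 1 ∧ 1 ≤ (ep (t + 1) ω).1 ∧ (ep (t + 1) ω).1 ≤ nv t ω
  ep_edgeStep : ∀ t, 1 ≤ t → ∀ ω, Z (t + 1) ω = false →
    1 ≤ (ep (t + 1) ω).1 ∧ (ep (t + 1) ω).1 ≤ nv t ω ∧
    1 ≤ (ep (t + 1) ω).2 ∧ (ep (t + 1) ω).2 ≤ nv t ω
  Z_meas : ∀ t, Measurable[ℱ t] (Z t)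
  nv_meas : ∀ t, Measurable[ℱ t] (nv t)
  ep_meas : ∀ t, Measurable[ℱ t] (ep t)
  condLaw_Z : ∀ t, 1 ≤ t →
    μ[Set.indicator {ω | Z (t + 1) ω = true} (fun _ => (1 : ℝ)) | ℱ t] =ᵐ[μ] fun _ => p
  condLaw_vertex : ∀ t, 1 ≤ t → ∀ u,
    μ[Set.indicator {ω | Z (t + 1) ω = true ∧ ep (t + 1) ω = (u, nv t ω + 1)}
        (fun _ => (1 : ℝ)) | ℱ t]
      =ᵐ[μ] fun ω => p * (degOf ep t u ω : ℝ) / (2 * t)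
  condLaw_edge : ∀ t, 1 ≤ t → ∀ u w,
    μ[Set.indicator {ω | Z (t + 1) ω = false ∧ ep (t + 1) ω = (u, w)}
        (fun _ => (1 : ℝ)) | ℱ t]
      =ᵐ[μ] fun ω => (1 - p) * (degOf ep t u ω : ℝ) * (degOf ep t w ω : ℝ) / (2 * t) ^ 2

namespace PAProcess

variable {p : ℝ} (P : PAProcess p)

/-- degree `d_t(i)` of vertex `i` in `G_t` (`0` if `i` is not yet present). -/
noncomputable def deg (t i : ℕ) (ω : P.Ω) : ℕ := degOf P.ep t i ω

/-- `i` and `j` are joined by at least one edge in `G_t`. -/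
def Joined (t i j : ℕ) (ω : P.Ω) : Prop :=
  ∃ s ∈ Finset.Icc 1 t, P.ep s ω = (i, j) ∨ P.ep s ω = (j, i)

/-- number of triangles of `G_t`: sets of three distinct vertices pairwise joined by at
least one edge (counted without edge multiplicities). -/
noncomputable def triangles (t : ℕ) (ω : P.Ω) : ℕ :=
  ((Finset.Icc 1 t ×ˢ Finset.Icc 1 t ×ˢ Finset.Icc 1 t).filter
    (fun q => q.1 < q.2.1 ∧ q.2.1 < q.2.2 ∧ P.Joined t q.1 q.2.1 ω ∧
      P.Joined t q.1 q.2.2 ω ∧ P.Joined t q.2.1 q.2.2 ω)).card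

/-- number of cherries (paths of length 2) of `G_t`: unordered pairs of distinct edges of
`G_t` sharing a common endpoint.  The edges of `G_t` are indexed by their creation times
`1 ≤ s ≤ t`. -/
noncomputable def cherries (t : ℕ) (ω : P.Ω) : ℕ :=
  ((Finset.Icc 1 t ×ˢ Finset.Icc 1 t).filter
    (fun q => q.1 < q.2 ∧
      ((P.ep q.1 ω).1 = (P.ep q.2 ω).1 ∨ (P.ep q.1 ω).1 = (P.ep q.2 ω).2 ∨
       (P.ep q.1 ω).2 = (P.ep q.2 ω).1 ∨ (P.ep q.1 ω).2 = (P.ep q.2 ω).2))).card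

/-- global clustering coefficient of `G_t`. -/
noncomputable def clustering (t : ℕ) (ω : P.Ω) : ℝ :=
  3 * (P.triangles t ω : ℝ) / (P.cherries t ω : ℝ)

/-- clique number of `G_t`: the largest `k` such that `G_t` contains `k` distinct vertices
pairwise joined by at least one edge. -/
noncomputable def cliqueNum (t : ℕ) (ω : P.Ω) : ℕ :=
  sSup {k | ∃ S : Finset ℕ, S ⊆ Finset.Icc 1 (P.nv t ω) ∧ S.card = k ∧
    ∀ i ∈ S, ∀ j ∈ S, i ≠ j → P.Joined t i j ω}

/-- `Γ_t(j)`: the number of distinct vertices joined to `j` by at least one edge in `G_t`. -/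
noncomputable def nbrCount (t j : ℕ) (ω : P.Ω) : ℕ :=
  ((Finset.Icc 1 t).filter (fun i => P.Joined t i j ω)).card

/-- the time at which vertex `j` is added to the graph. -/
noncomputable def addTime (j : ℕ) (ω : P.Ω) : ℕ := sInf {t | P.nv t ω = j}

/-- at step `s` an edge joining `i` and `j` is added by an edge-step. -/
def EdgeStepEdge (s i j : ℕ) (ω : P.Ω) : Prop :=
  2 ≤ s ∧ P.Z s ω = false ∧ (P.ep s ω = (i, j) ∨ P.ep s ω = (j, i))

/-- at step `s` an edge joining `i` and `j` is added by a vertex-step. -/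
def VertexStepEdge (s i j : ℕ) (ω : P.Ω) : Prop :=
  2 ≤ s ∧ P.Z s ω = true ∧ (P.ep s ω = (i, j) ∨ P.ep s ω = (j, i))

/-- at step `s` vertex `j` is added by a vertex-step and its attaching edge connects it
to vertex `i`. -/
def AttachEdge (s i j : ℕ) (ω : P.Ω) : Prop :=
  2 ≤ s ∧ P.Z s ω = true ∧ P.ep s ω = (i, j) ∧ P.nv s ω = j

/-- `i` and `j` are joined in `G_t` by at least one edge created at an edge-step. -/
def EdgeJoined (t i j : ℕ) (ω : P.Ω) : Prop :=
  ∃ s ∈ Finset.Icc 1 t, P.EdgeStepEdge s i j ω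

/-- `i` and `j` are joined in `G_t` by at least one edge created at a vertex-step. -/
def VJoined (t i j : ℕ) (ω : P.Ω) : Prop :=
  ∃ s ∈ Finset.Icc 1 t, P.VertexStepEdge s i j ω

/-- `i` and `j` are joined in `G_t`, and exclusively by edges created at vertex-steps. -/
def OnlyVertexJoined (t i j : ℕ) (ω : P.Ω) : Prop :=
  P.Joined t i j ω ∧
    ∀ s ∈ Finset.Icc 1 t, (P.ep s ω = (i, j) ∨ P.ep s ω = (j, i)) → P.Z s ω = true

end PAProcess

namespace PAProcess

attribute [local instance] PAProcess.m0 PAProcess.isProb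

variable {p : ℝ} (P : PAProcess p)

lemma deg_succ (t i : ℕ) (ω : P.Ω) :
    P.deg (t + 1) i ω = P.deg t i ω +
      ((if (P.ep (t + 1) ω).1 = i then 1 else 0) + (if (P.ep (t + 1) ω).2 = i then 1 else 0)) := by
  unfold deg degOf
  rw [Finset.sum_Icc_succ_top (by omega)]

lemma two_le_deg_one {t : ℕ} (ht : 1 ≤ t) (ω : P.Ω) : 2 ≤ P.deg t 1 ω := by
  induction t, ht using Nat.le_induction with
  | base => simp [deg, degOf, P.ep_one]
  | succ t _ ih => rw [deg_succ]; omega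

lemma one_le_nv {t : ℕ} (ht : 1 ≤ t) (ω : P.Ω) : 1 ≤ P.nv t ω := by
  induction t, ht using Nat.le_induction with
  | base => simp [P.nv_one]
  | succ t ht ih => rw [P.nv_succ t ht]; omega

lemma nv_le {t : ℕ} (ht : 1 ≤ t) (ω : P.Ω) : P.nv t ω ≤ t := by
  induction t, ht using Nat.le_induction with
  | base => simp [P.nv_one]
  | succ t ht ih => rw [P.nv_succ t ht]; split_ifs <;> omega

lemma ep_mem_Icc {s : ℕ} (hs : 1 ≤ s) (ω : P.Ω) :
    (P.ep s ω).1 ∈ Finset.Icc 1 s ∧ (P.ep s ω).2 ∈ Finset.Icc 1 s := by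
  obtain rfl | ⟨t, ht, rfl⟩ : s = 1 ∨ ∃ t, 1 ≤ t ∧ s = t + 1 := by
    rcases Nat.lt_or_ge 1 s with h | h
    · exact Or.inr ⟨s - 1, by omega, by omega⟩
    · exact Or.inl (by omega)
  · simp [P.ep_one]
  · have hn := P.nv_le ht ω
    simp only [Finset.mem_Icc]
    cases hZ : P.Z (t + 1) ω with
    | true => have := P.ep_vertexStep t ht ω hZ; omega
    | false => have := P.ep_edgeStep t ht ω hZ; omega

lemma sum_deg (t : ℕ) (ω : P.Ω) : ∑ i ∈ Finset.Icc 1 t, P.deg t i ω = 2 * t := by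
  unfold deg degOf
  rw [Finset.sum_comm]
  have h : ∀ s ∈ Finset.Icc 1 t, ∑ i ∈ Finset.Icc 1 t,
      ((if (P.ep s ω).1 = i then 1 else 0) + (if (P.ep s ω).2 = i then 1 else 0)) = 2 := by
    intro s hs
    have hs' := Finset.mem_Icc.1 hs
    have hm := P.ep_mem_Icc hs'.1 ω
    simp only [Finset.mem_Icc] at hm
    rw [Finset.sum_add_distrib, Finset.sum_ite_eq, Finset.sum_ite_eq,
      if_pos (Finset.mem_Icc.2 (by omega)), if_pos (Finset.mem_Icc.2 (by omega))]
  rw [Finset.sum_congr rfl h]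
  simp [mul_comm]

lemma measurable_deg (t i : ℕ) : Measurable[P.ℱ t] (P.deg t i) := by
  unfold deg degOf
  refine Finset.measurable_fun_sum _ fun s hs => ?_
  have hep : Measurable[P.ℱ t] (P.ep s) :=
    (P.ep_meas s).mono (P.ℱ.mono (Finset.mem_Icc.1 hs).2) le_rfl
  exact (measurable_of_countable
    (fun q : ℕ × ℕ => (if q.1 = i then 1 else 0) + (if q.2 = i then 1 else 0))).comp hep

/-- The inverse of the degree of the first vertex, shifted so that it contracts in conditional
mean at each step by a factor that does not depend on the degree, up to a summable error. -/
noncomputable def invDeg (t : ℕ) (ω : P.Ω) : ℝ := ((P.deg t 1 ω : ℝ) - 1)⁻¹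

lemma two_le_cast_deg_one {t : ℕ} (ht : 1 ≤ t) (ω : P.Ω) : (2 : ℝ) ≤ P.deg t 1 ω := by
  exact_mod_cast P.two_le_deg_one ht ω

lemma invDeg_nonneg {t : ℕ} (ht : 1 ≤ t) (ω : P.Ω) : 0 ≤ P.invDeg t ω := by
  have := P.two_le_cast_deg_one ht ω
  exact inv_nonneg.2 (by linarith)

lemma invDeg_le_one {t : ℕ} (ht : 1 ≤ t) (ω : P.Ω) : P.invDeg t ω ≤ 1 := by
  have := P.two_le_cast_deg_one ht ω
  exact inv_le_one_of_one_le₀ (by linarith)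

lemma integrable_comp_deg (f : ℕ → ℝ) {t : ℕ} (hf : ∀ d, 2 ≤ d → |f d| ≤ 1) (ht : 1 ≤ t) :
    Integrable (fun ω => f (P.deg t 1 ω)) P.μ := by
  refine Integrable.of_bound (C := 1) ?_ (ae_of_all _ fun ω => hf _ (P.two_le_deg_one ht ω))
  exact ((measurable_of_countable f).comp
    ((P.measurable_deg t 1).mono (P.ℱ.le t) le_rfl)).aestronglyMeasurable

lemma integrable_invDeg {t : ℕ} (ht : 1 ≤ t) : Integrable (P.invDeg t) P.μ := by
  refine P.integrable_comp_deg (fun d => ((d : ℝ) - 1)⁻¹) (fun d hd => ?_) ht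
  have : (2 : ℝ) ≤ d := by exact_mod_cast hd
  rw [abs_of_nonneg (inv_nonneg.2 (by linarith))]
  exact inv_le_one_of_one_le₀ (by linarith)

/-- Two integrable functions with the same integral. -/
def SameIntegral (f g : P.Ω → ℝ) : Prop :=
  Integrable f P.μ ∧ Integrable g P.μ ∧ ∫ ω, f ω ∂P.μ = ∫ ω, g ω ∂P.μ

variable {P} in
lemma SameIntegral.add {f f' g g' : P.Ω → ℝ} (h : P.SameIntegral f g)
    (h' : P.SameIntegral f' g') :
    P.SameIntegral (fun ω => f ω + f' ω) (fun ω => g ω + g' ω) :=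
  ⟨h.1.add h'.1, h.2.1.add h'.2.1, by
    rw [integral_add h.1 h'.1, integral_add h.2.1 h'.2.1, h.2.2, h'.2.2]⟩

variable {P} in
lemma SameIntegral.sum {ι : Type*} (s : Finset ι) {f g : ι → P.Ω → ℝ}
    (h : ∀ i, P.SameIntegral (f i) (g i)) :
    P.SameIntegral (fun ω => ∑ i ∈ s, f i ω) (fun ω => ∑ i ∈ s, g i ω) :=
  ⟨integrable_finsetSum _ fun i _ => (h i).1, integrable_finsetSum _ fun i _ => (h i).2.1, by
    rw [integral_finsetSum _ fun i _ => (h i).1, integral_finsetSum _ fun i _ => (h i).2.1]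
    exact Finset.sum_congr rfl fun i _ => (h i).2.2⟩

/-- A function of the current degree may be integrated against the conditional probability of an
event instead of its indicator. -/
lemma sameIntegral_comp_deg_mul_indicator (f : ℕ → ℝ) {t : ℕ} (hf : ∀ d, 2 ≤ d → |f d| ≤ 1)
    (ht : 1 ≤ t) {A : Set P.Ω} (hA : MeasurableSet A) {r : P.Ω → ℝ}
    (hr : P.μ[A.indicator (fun _ => (1 : ℝ)) | P.ℱ t] =ᵐ[P.μ] r) :
    P.SameIntegral (fun ω => f (P.deg t 1 ω) * A.indicator (fun _ => (1 : ℝ)) ω)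
      (fun ω => f (P.deg t 1 ω) * r ω) := by
  have hsm : StronglyMeasurable[P.ℱ t] (fun ω => f (P.deg t 1 ω)) :=
    ((measurable_of_countable f).comp (P.measurable_deg t 1)).stronglyMeasurable
  have hI : Integrable (A.indicator (fun _ => (1 : ℝ))) P.μ :=
    (integrable_const (1 : ℝ)).indicator hA
  have hint : Integrable ((fun ω => f (P.deg t 1 ω)) * A.indicator (fun _ => (1 : ℝ))) P.μ :=
    hI.bdd_mul (c := 1) (hsm.mono (P.ℱ.le t)).aestronglyMeasurable
      (ae_of_all _ fun ω => hf _ (P.two_le_deg_one ht ω))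
  have hce := condExp_mul_of_stronglyMeasurable_left hsm hint hI
  have hce' : P.μ[(fun ω => f (P.deg t 1 ω)) * A.indicator (fun _ => (1 : ℝ)) | P.ℱ t]
      =ᵐ[P.μ] fun ω => f (P.deg t 1 ω) * r ω := by
    filter_upwards [hce, hr] with ω h1 h2
    rw [h1, Pi.mul_apply, h2]
  refine ⟨hint, integrable_condExp.congr hce', ?_⟩
  rw [← integral_congr_ae hce', integral_condExp (P.ℱ.le t)]
  rfl

/-- The event that step `t + 1` attaches a new vertex to `u`. -/
def vertexEvent (t u : ℕ) : Set P.Ω :=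
  {ω | P.Z (t + 1) ω = true ∧ P.ep (t + 1) ω = (u, P.nv t ω + 1)}

/-- The event that step `t + 1` is an edge-step with ordered endpoints `(u, w)`. -/
def edgeEvent (t u w : ℕ) : Set P.Ω :=
  {ω | P.Z (t + 1) ω = false ∧ P.ep (t + 1) ω = (u, w)}

lemma measurableSet_vertexEvent (t u : ℕ) : MeasurableSet (P.vertexEvent t u) := by
  have hZ : Measurable (P.Z (t + 1)) := (P.Z_meas (t + 1)).mono (P.ℱ.le _) le_rfl
  have he : Measurable (P.ep (t + 1)) := (P.ep_meas (t + 1)).mono (P.ℱ.le _) le_rfl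
  have hn : Measurable (P.nv t) := (P.nv_meas t).mono (P.ℱ.le _) le_rfl
  refine (hZ (measurableSet_singleton true)).inter (measurableSet_eq_fun he ?_)
  exact (measurable_of_countable (fun n : ℕ => (u, n + 1))).comp hn

lemma measurableSet_edgeEvent (t u w : ℕ) : MeasurableSet (P.edgeEvent t u w) := by
  have hZ : Measurable (P.Z (t + 1)) := (P.Z_meas (t + 1)).mono (P.ℱ.le _) le_rfl
  have he : Measurable (P.ep (t + 1)) := (P.ep_meas (t + 1)).mono (P.ℱ.le _) le_rfl
  exact (hZ (measurableSet_singleton false)).inter (he (measurableSet_singleton (u, w)))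

/-- The decrease of `(d - 1)⁻¹` when `d` grows by one. -/
noncomputable def singleDrop (d : ℕ) : ℝ := ((d : ℝ) - 1)⁻¹ - (d : ℝ)⁻¹

/-- The second difference of `d ↦ (d - 1)⁻¹`, up to sign. -/
noncomputable def loopCorrection (d : ℕ) : ℝ :=
  ((d : ℝ) - 1)⁻¹ - ((d : ℝ) + 1)⁻¹ - 2 * (((d : ℝ) - 1)⁻¹ - (d : ℝ)⁻¹)

lemma singleDrop_eq {d : ℕ} (hd : 2 ≤ d) : singleDrop d = 1 / ((d - 1) * d : ℝ) := by
  have : (2 : ℝ) ≤ d := by exact_mod_cast hd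
  have h1 : (d : ℝ) - 1 ≠ 0 := by linarith
  have h2 : (d : ℝ) ≠ 0 := by linarith
  unfold singleDrop
  field_simp
  ring

lemma loopCorrection_eq {d : ℕ} (hd : 2 ≤ d) :
    loopCorrection d = -(2 / ((d - 1) * d * (d + 1) : ℝ)) := by
  have : (2 : ℝ) ≤ d := by exact_mod_cast hd
  have h1 : (d : ℝ) - 1 ≠ 0 := by linarith
  have h2 : (d : ℝ) ≠ 0 := by linarith
  have h3 : (d : ℝ) + 1 ≠ 0 := by linarith
  unfold loopCorrection
  field_simp
  ring

lemma abs_singleDrop_le {d : ℕ} (hd : 2 ≤ d) : |singleDrop d| ≤ 1 := by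
  have : (2 : ℝ) ≤ d := by exact_mod_cast hd
  rw [singleDrop_eq hd, abs_of_nonneg (by apply div_nonneg <;> nlinarith), div_le_one (by nlinarith)]
  nlinarith

lemma abs_loopCorrection_le {d : ℕ} (hd : 2 ≤ d) : |loopCorrection d| ≤ 1 := by
  have : (2 : ℝ) ≤ d := by exact_mod_cast hd
  have h : (2 : ℝ) ≤ (d - 1) * d := by nlinarith
  rw [loopCorrection_eq hd, abs_neg, abs_of_nonneg (by apply div_nonneg <;> nlinarith),
    div_le_one (by nlinarith)]
  nlinarith

lemma invDeg_sub_invDeg_succ {t : ℕ} (ht : 1 ≤ t) (ω : P.Ω) :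
    P.invDeg t ω - P.invDeg (t + 1) ω =
      singleDrop (P.deg t 1 ω) * (P.vertexEvent t 1).indicator (fun _ => (1 : ℝ)) ω +
      ∑ w ∈ Finset.Icc 1 t,
        (singleDrop (P.deg t 1 ω) * (P.edgeEvent t 1 w).indicator (fun _ => (1 : ℝ)) ω +
          singleDrop (P.deg t 1 ω) * (P.edgeEvent t w 1).indicator (fun _ => (1 : ℝ)) ω) +
      loopCorrection (P.deg t 1 ω) * (P.edgeEvent t 1 1).indicator (fun _ => (1 : ℝ)) ω := by
  have hn := P.one_le_nv ht ω
  have hnt := P.nv_le ht ω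
  simp only [Set.indicator_apply, vertexEvent, edgeEvent, Set.mem_ofPred_eq, invDeg, deg_succ,
    Prod.ext_iff, Finset.sum_add_distrib, ← Finset.mul_sum]
  rcases Bool.eq_false_or_eq_true (P.Z (t + 1) ω) with hZ | hZ
  · have h := P.ep_vertexStep t ht ω hZ
    have hn0 : P.nv t ω ≠ 0 := by omega
    by_cases h1 : (P.ep (t + 1) ω).1 = 1 <;> simp [hZ, h1, h.1, hn0, singleDrop]
  · have h := P.ep_edgeStep t ht ω hZ
    have hle1 : (P.ep (t + 1) ω).1 ≤ t := by omega
    have hle2 : (P.ep (t + 1) ω).2 ≤ t := by omega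
    by_cases h1 : (P.ep (t + 1) ω).1 = 1 <;> by_cases h2 : (P.ep (t + 1) ω).2 = 1 <;>
      simp [hZ, h1, h2, h.1, h.2.2.1, ht, hle1, hle2, singleDrop, loopCorrection]
    ring

lemma sameIntegral_invDeg_sub_succ {t : ℕ} (ht : 1 ≤ t) :
    P.SameIntegral (fun ω => P.invDeg t ω - P.invDeg (t + 1) ω)
      (fun ω => singleDrop (P.deg t 1 ω) * ((2 - p) * (P.deg t 1 ω / (2 * t))) +
        loopCorrection (P.deg t 1 ω) * ((1 - p) * (P.deg t 1 ω / (2 * t)) ^ 2)) := by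
  have hV := P.sameIntegral_comp_deg_mul_indicator singleDrop (fun _ => abs_singleDrop_le) ht
    (P.measurableSet_vertexEvent t 1) (P.condLaw_vertex t ht 1)
  have hE := fun u w => P.sameIntegral_comp_deg_mul_indicator singleDrop (fun _ => abs_singleDrop_le) ht
    (P.measurableSet_edgeEvent t u w) (P.condLaw_edge t ht u w)
  have hL := P.sameIntegral_comp_deg_mul_indicator loopCorrection (fun _ => abs_loopCorrection_le) ht
    (P.measurableSet_edgeEvent t 1 1) (P.condLaw_edge t ht 1 1)
  simp only [P.invDeg_sub_invDeg_succ ht]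
  convert (hV.add (SameIntegral.sum (Finset.Icc 1 t) fun w => (hE 1 w).add (hE w 1))).add hL
    using 2 with ω
  have hs : ∑ w ∈ Finset.Icc 1 t, (P.deg t w ω : ℝ) = 2 * t := by
    exact_mod_cast P.sum_deg t ω
  have ht0 : (t : ℝ) ≠ 0 := by positivity
  have hw : ∀ w ∈ Finset.Icc 1 t,
      singleDrop (P.deg t 1 ω) * ((1 - p) * (P.deg t 1 ω : ℝ) * (P.deg t w ω : ℝ) / (2 * t) ^ 2) +
      singleDrop (P.deg t 1 ω) * ((1 - p) * (P.deg t w ω : ℝ) * (P.deg t 1 ω : ℝ) / (2 * t) ^ 2) =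
      singleDrop (P.deg t 1 ω) * (2 * (1 - p) * (P.deg t 1 ω : ℝ) / (2 * t) ^ 2) *
        (P.deg t w ω : ℝ) := fun w _ => by ring
  have hsum := Finset.sum_congr rfl hw
  rw [← Finset.mul_sum, hs] at hsum
  simp only [deg] at hsum ⊢
  rw [hsum]
  field_simp
  ring

lemma integral_invDeg_succ_le (hp0 : 0 < p) (hp1 : p < 1) {t : ℕ} (ht : 1 ≤ t) :
    ∫ ω, P.invDeg (t + 1) ω ∂P.μ ≤
      (1 - (1 - p / 2) / t + 1 / (2 * (t : ℝ) ^ 2)) * ∫ ω, P.invDeg t ω ∂P.μ := by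
  have ht0 : (0 : ℝ) < t := by positivity
  have hsub := integral_sub (P.integrable_invDeg ht) (P.integrable_invDeg (t := t + 1) (by omega))
  have hsame := P.sameIntegral_invDeg_sub_succ ht
  have key : ∫ ω, ((1 - p / 2) / t - 1 / (2 * (t : ℝ) ^ 2)) * P.invDeg t ω ∂P.μ ≤
      ∫ ω, (P.invDeg t ω - P.invDeg (t + 1) ω) ∂P.μ := by
    rw [hsame.2.2]
    refine integral_mono ((P.integrable_invDeg ht).const_mul _) hsame.2.1 fun ω => ?_
    · have hD := P.two_le_cast_deg_one ht ω
      have hD' := P.two_le_deg_one ht ω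
      simp only [invDeg, singleDrop_eq hD', loopCorrection_eq hD']
      generalize (P.deg t 1 ω : ℝ) = D at hD
      have h1 : 0 < D - 1 := by linarith
      have h2 : 0 < D := by linarith
      have h3 : 0 < D + 1 := by linarith
      have hid : 1 / ((D - 1) * D) * ((2 - p) * (D / (2 * t))) +
          -(2 / ((D - 1) * D * (D + 1))) * ((1 - p) * (D / (2 * t)) ^ 2) -
          ((1 - p / 2) / t - 1 / (2 * (t : ℝ) ^ 2)) * (D - 1)⁻¹ =
          (1 + p * D) / (2 * t ^ 2 * (D - 1) * (D + 1)) := by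
        field_simp
        ring
      have : 0 ≤ (1 + p * D) / (2 * (t : ℝ) ^ 2 * (D - 1) * (D + 1)) := by positivity
      linarith
  rw [integral_const_mul, hsub] at key
  linarith

lemma integral_invDeg_le (hp0 : 0 < p) (hp1 : p < 1) {t : ℕ} (ht : 1 ≤ t) :
    ∫ ω, P.invDeg t ω ∂P.μ ≤ Real.exp (1 - 1 / t) * (t : ℝ) ^ (-(1 - p / 2)) := by
  induction t, ht using Nat.le_induction with
  | base => simp [invDeg, deg, degOf, P.ep_one]; norm_num
  | succ t ht ih =>
    have ht0 : (0 : ℝ) < t := by positivity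
    have ht1 : (1 : ℝ) ≤ t := by exact_mod_cast ht
    have hI : 0 ≤ ∫ ω, P.invDeg t ω ∂P.μ := integral_nonneg (P.invDeg_nonneg ht)
    have hpow : (t : ℝ) ^ (-(1 - p / 2)) ≤
        Real.exp ((1 - p / 2) / t) * ((t + 1 : ℕ) : ℝ) ^ (-(1 - p / 2)) := by
      rw [Real.rpow_def_of_pos ht0, Real.rpow_def_of_pos (by positivity), ← Real.exp_add,
        Real.exp_le_exp]
      have hlog : Real.log ((t + 1 : ℕ) : ℝ) - Real.log t ≤ 1 / t := by
        rw [← Real.log_div (by positivity) (by positivity)]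
        have := Real.log_le_sub_one_of_pos (x := ((t + 1 : ℕ) : ℝ) / t) (by positivity)
        have he : ((t + 1 : ℕ) : ℝ) / t - 1 = 1 / t := by push_cast; field_simp; ring
        linarith
      have := mul_le_mul_of_nonneg_left hlog (show 0 ≤ 1 - p / 2 by linarith)
      have he : (1 - p / 2) * (1 / (t : ℝ)) = (1 - p / 2) / t := by ring
      linarith
    have hsq : 1 / (2 * (t : ℝ) ^ 2) ≤ 1 / t - 1 / ((t + 1 : ℕ) : ℝ) := by
      push_cast
      rw [div_sub_div _ _ (by positivity) (by positivity), div_le_div_iff₀ (by positivity)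
        (by positivity)]
      nlinarith
    calc ∫ ω, P.invDeg (t + 1) ω ∂P.μ
        ≤ (1 - (1 - p / 2) / t + 1 / (2 * (t : ℝ) ^ 2)) * ∫ ω, P.invDeg t ω ∂P.μ :=
          P.integral_invDeg_succ_le hp0 hp1 ht
      _ ≤ Real.exp (-((1 - p / 2) / t) + 1 / (2 * (t : ℝ) ^ 2)) *
          (Real.exp (1 - 1 / t) *
            (Real.exp ((1 - p / 2) / t) * ((t + 1 : ℕ) : ℝ) ^ (-(1 - p / 2)))) := by
          refine mul_le_mul ?_ (ih.trans (by gcongr)) hI (Real.exp_pos _).le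
          have := Real.add_one_le_exp (-((1 - p / 2) / t) + 1 / (2 * (t : ℝ) ^ 2))
          linarith
      _ = Real.exp (1 - 1 / t + 1 / (2 * (t : ℝ) ^ 2)) *
          ((t + 1 : ℕ) : ℝ) ^ (-(1 - p / 2)) := by
          rw [← mul_assoc, ← mul_assoc, ← Real.exp_add, ← Real.exp_add]
          congr 2
          ring
      _ ≤ Real.exp (1 - 1 / ((t + 1 : ℕ) : ℝ)) * ((t + 1 : ℕ) : ℝ) ^ (-(1 - p / 2)) := by
          gcongr
          linarith

/-- Lower tail of the degree of the first vertex, by Markov's inequality for `invDeg`. -/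
lemma one_sub_le_measureReal_deg_one (hp0 : 0 < p) (hp1 : p < 1) {t : ℕ} (ht : 1 ≤ t) (a : ℝ) :
    1 - Real.exp 1 * (t : ℝ) ^ (a - (1 - p / 2)) ≤
      P.μ.real {ω | (t : ℝ) ^ a ≤ (P.deg t 1 ω : ℝ)} := by
  have ht0 : (0 : ℝ) < t := by positivity
  have hmeas : MeasurableSet {ω | (t : ℝ) ^ a ≤ (P.deg t 1 ω : ℝ)} :=
    ((P.measurable_deg t 1).mono (P.ℱ.le t) le_rfl)
      (Set.to_countable {d : ℕ | (t : ℝ) ^ a ≤ (d : ℝ)}).measurableSet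
  have hmarkov := mul_meas_ge_le_integral_of_nonneg (ae_of_all _ (P.invDeg_nonneg ht))
    (P.integrable_invDeg ht) ((t : ℝ) ^ (-a))
  have hsub : P.μ.real {ω | (t : ℝ) ^ a ≤ (P.deg t 1 ω : ℝ)}ᶜ ≤
      P.μ.real {ω | (t : ℝ) ^ (-a) ≤ P.invDeg t ω} := by
    refine measureReal_mono fun ω hω => ?_
    simp only [Set.mem_compl_iff, Set.mem_ofPred_eq, not_le] at hω ⊢
    have := P.two_le_cast_deg_one ht ω
    rw [Real.rpow_neg ht0.le, invDeg]
    exact inv_anti₀ (by linarith) (by linarith)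
  have hexp : Real.exp (1 - 1 / t) ≤ Real.exp 1 := by
    rw [Real.exp_le_exp]
    have : 0 ≤ 1 / (t : ℝ) := by positivity
    linarith
  have hbound : P.μ.real {ω | (t : ℝ) ^ (-a) ≤ P.invDeg t ω} ≤
      Real.exp 1 * (t : ℝ) ^ (a - (1 - p / 2)) := by
    have h := hmarkov.trans ((P.integral_invDeg_le hp0 hp1 ht).trans
      (mul_le_mul_of_nonneg_right hexp (by positivity)))
    have h' := mul_le_mul_of_nonneg_left h (show 0 ≤ (t : ℝ) ^ a by positivity)
    rw [← mul_assoc, ← Real.rpow_add ht0, add_neg_cancel, Real.rpow_zero, one_mul] at h'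
    refine h'.trans_eq ?_
    rw [sub_eq_add_neg a, Real.rpow_add ht0]
    ring
  have := probReal_add_probReal_compl (μ := P.μ) hmeas
  linarith

end PAProcess

/-- **Corollary (existence of a high-degree vertex).**
For `p ∈ (0,1)`, `c_p = 1 - p/2` and every `ε > 0` there are positive constants `C₁, C₂, δ`
(depending only on `ε` and `p`) such that for all `t ≥ 1`,
`P(∃ j ∈ G_t, d_t(j) ≥ C₁ t^{c_p(1-ε)}) ≥ 1 - C₂ t^{-δ}`. -/
theorem exists_high_degree_vertex (p : ℝ) (hp0 : 0 < p) (hp1 : p < 1)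
    (P : PAProcess p) (ε : ℝ) (hε : 0 < ε) :
    ∃ C₁ C₂ δ : ℝ, 0 < C₁ ∧ 0 < C₂ ∧ 0 < δ ∧
      ∀ t : ℕ, 1 ≤ t →
        1 - C₂ * (t : ℝ) ^ (-δ) ≤
          (P.μ {ω | ∃ j : ℕ, 1 ≤ j ∧ j ≤ P.nv t ω ∧
            C₁ * (t : ℝ) ^ ((1 - p / 2) * (1 - ε)) ≤ (P.deg t j ω : ℝ)}).toReal := by
  have : IsProbabilityMeasure P.μ := P.isProb
  refine ⟨1, Real.exp 1, (1 - p / 2) * ε, one_pos, Real.exp_pos 1,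
    mul_pos (by linarith) hε, fun t ht => ?_⟩
  have h := P.one_sub_le_measureReal_deg_one hp0 hp1 ht ((1 - p / 2) * (1 - ε))
  rw [show (1 - p / 2) * (1 - ε) - (1 - p / 2) = -((1 - p / 2) * ε) by ring] at h
  refine h.trans (measureReal_mono fun ω hω => ⟨1, le_rfl, P.one_le_nv ht ω, ?_⟩)
  simpa using hω
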